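/- Let m ≥ 2 and n be positive integers, and let B ∈ ℝ^{n×n} be an invertible matrix with nonnegative entries. Then the complete product map 𝒳 ↦ ⟦B⟧·𝒳 fixes the identity tensor, i.e. ⟦B⟧·ℐ = ℐ, if and only if B is a permutation matrix. -/

import Mathlib

open Finset

/-- The complete product `⟦B⟧·𝒳` of an `m`-th order `n`-dimensional tensor `𝒳` by a matrix
`B ∈ ℝ^{n×n}`: `(⟦B⟧·𝒳)_{i_1…i_m} = Σ_{(j_1,…,j_m)∈[n]^m} B_{i_1 j_1} ⋯ B_{i_m j_m} X_{j_1…j_m}`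
(multi-indices encoded as functions `Fin m → Fin n`). -/
def completeProd {m n : ℕ} (B : Matrix (Fin n) (Fin n) ℝ) (X : (Fin m → Fin n) → ℝ) :
    (Fin m → Fin n) → ℝ :=
  fun i => ∑ j : Fin m → Fin n, (∏ s : Fin m, B (i s) (j s)) * X j

/-- The identity tensor `ℐ`: its entry at `(i_1,…,i_m)` is `1` if `i_1 = i_2 = ⋯ = i_m`
and `0` otherwise. -/
def idTensor (m n : ℕ) : (Fin m → Fin n) → ℝ :=
  fun i => if ∀ s t : Fin m, i s = i t then 1 else 0

lemma completeProd_idTensor_apply (m n : ℕ) (hm : 2 ≤ m)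
    (B : Matrix (Fin n) (Fin n) ℝ) (i : Fin m → Fin n) :
    completeProd B (idTensor m n) i = ∑ k : Fin n, ∏ s : Fin m, B (i s) k := by
  unfold completeProd idTensor
  simp only [mul_ite, mul_one, mul_zero]
  rw [← Finset.sum_filter]
  symm
  refine Finset.sum_bij (fun k _ => fun _ => k) ?_ ?_ ?_ ?_
  · intro k _
    simp
  · intro a _ b _ h
    exact congrFun h ⟨0, by omega⟩
  · intro j hj
    rw [Finset.mem_filter] at hj
    exact ⟨j ⟨0, by omega⟩, Finset.mem_univ _, funext fun s => hj.2 _ _⟩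
  · intro k _
    rfl

/-- Let `m ≥ 2`, `n ≥ 1`, and let `B ∈ ℝ^{n×n}` be invertible with nonnegative entries.
Then `⟦B⟧·ℐ = ℐ` if and only if `B` is a permutation matrix. -/
theorem completeProd_fixes_idTensor_iff (m n : ℕ) (hm : 2 ≤ m) (hn : 0 < n)
    (B : Matrix (Fin n) (Fin n) ℝ) (hB : IsUnit B) (hBnn : ∀ i j, 0 ≤ B i j) :
    completeProd B (idTensor m n) = idTensor m n ↔
      ∃ σ : Equiv.Perm (Fin n), B = σ.permMatrix ℝ := by
  have pm : ∀ (σ : Equiv.Perm (Fin n)) (i j : Fin n),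
      σ.permMatrix ℝ i j = if σ i = j then 1 else 0 := by
    intro σ i j
    simp [Equiv.Perm.permMatrix, PEquiv.toMatrix_apply, eq_comm]
  let s0 : Fin m := ⟨0, by omega⟩
  let s1 : Fin m := ⟨1, by omega⟩
  have h01 : s1 ≠ s0 := by simp [s0, s1]
  constructor
  · intro h
    have key : ∀ i : Fin m → Fin n,
        ∑ k : Fin n, ∏ s : Fin m, B (i s) k = idTensor m n i := by
      intro i
      rw [← completeProd_idTensor_apply m n hm, h]
    have hrow : ∀ a, ∑ k : Fin n, B a k ^ m = 1 := by
      intro a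
      have := key (fun _ => a)
      simpa [idTensor] using this
    have hcol : ∀ a b k, a ≠ b → B a k ≠ 0 → B b k ≠ 0 → False := by
      intro a b k hab ha hb
      have h1 := key (fun s => if s = s0 then a else b)
      have h2 : idTensor m n (fun s => if s = s0 then a else b) = 0 := by
        unfold idTensor
        rw [if_neg]
        intro hc
        have := hc s0 s1
        simp [h01] at this
        exact hab this
      rw [h2, Finset.sum_eq_zero_iff_of_nonneg
        (fun k _ => Finset.prod_nonneg fun s _ => hBnn _ _)] at h1
      have h3 := h1 k (Finset.mem_univ _)
      rw [Finset.prod_eq_zero_iff] at h3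
      obtain ⟨s, _, hs⟩ := h3
      split_ifs at hs
      · exact ha hs
      · exact hb hs
    have hex : ∀ a, ∃ k, B a k ≠ 0 := by
      intro a
      by_contra! hc
      have := hrow a
      simp [hc, show m ≠ 0 by omega] at this
    choose f hf using hex
    have hinj : Function.Injective f := by
      intro a b hab
      by_contra hne
      exact hcol a b (f a) hne (hf a) (by rw [hab]; exact hf b)
    have hbij : Function.Bijective f := Finite.injective_iff_bijective.mp hinj
    have hz : ∀ a k, f a ≠ k → B a k = 0 := by
      intro a k hk
      obtain ⟨b, rfl⟩ := hbij.2 k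
      by_contra hne
      exact hcol a b (f b) (fun e => hk (by rw [e])) hne (hf b)
    refine ⟨Equiv.ofBijective f hbij, ?_⟩
    ext a k
    rw [pm, Equiv.ofBijective_apply]
    split_ifs with hk
    · subst hk
      have h1 := hrow a
      rw [Finset.sum_eq_single (f a)
        (fun k _ hk => by rw [hz a k hk.symm, zero_pow (by omega)]) (by simp)] at h1
      exact (pow_eq_one_iff_of_nonneg (hBnn _ _) (by omega)).mp h1
    · exact hz a k hk
  · rintro ⟨σ, rfl⟩
    funext i
    rw [completeProd_idTensor_apply m n hm]
    simp only [pm]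
    unfold idTensor
    split_ifs with hi
    · have : ∀ s, i s = i s0 := fun s => hi s s0
      simp only [this]
      rw [Finset.sum_eq_single (σ (i s0))]
      · simp
      · intro k _ hk
        exact Finset.prod_eq_zero (Finset.mem_univ s0) (if_neg hk.symm)
      · simp
    · push Not at hi
      obtain ⟨s, t, hst⟩ := hi
      refine Finset.sum_eq_zero fun k _ => ?_
      by_cases hs : σ (i s) = k
      · refine Finset.prod_eq_zero (Finset.mem_univ t) (if_neg ?_)
        intro ht
        exact hst (σ.injective (hs.trans ht.symm))
      · exact Finset.prod_eq_zero (Finset.mem_univ s) (if_neg hs)
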